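/- Let Ŝ be a groupwise calibrated deferring soft classifier and g₁, g₂ two groups whose conditional accuracy profiles are equal: 𝒫_{g₁} = 𝒫_{g₂}. Let D̂ be any hard deferring post-processor satisfying (1) group blindness and (2) D̂(⊥, g) = ⊥ for all g, and suppose the composed classifier Ŷ = D̂∘Ŝ satisfies Pr[Ŷ(X_{g_i}) = 1] > 0, Pr[Ŷ(X_{g_i}) = 0] > 0, and the conditional base rates lie strictly between 0 and 1 for i = 1, 2. Then PPV, NPV, cFPR, and cFNR are each equal across the two groups: PPV_{Ŷ,g₁} = PPV_{Ŷ,g₂}, NPV_{Ŷ,g₁} = NPV_{Ŷ,g₂}, cFPR_{Ŷ,g₁} = cFPR_{Ŷ,g₂}, and cFNR_{Ŷ,g₁} = cFNR_{Ŷ,g₂}. -/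

import Mathlib

open Finset
open scoped Classical

namespace GroupFairness

noncomputable section

variable {X 𝒢 Ω : Type*} [Fintype X] [Fintype Ω]

/-- The finset of members of group `g`. -/
def grp (Grp : X → 𝒢) (g : 𝒢) : Finset X :=
  Finset.univ.filter (fun x => Grp x = g)

/-- Expectation of `f x ω` over a uniformly random member `x` of group `g`,
together with internal randomness `ω` distributed according to the weights `w`. -/
def Ex (w : Ω → ℝ) (Grp : X → 𝒢) (g : 𝒢) (f : X → Ω → ℝ) : ℝ :=
  (∑ x ∈ grp Grp g, ∑ ω : Ω, w ω * f x ω) / ((grp Grp g).card : ℝ)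

/-- Probability of the event `E x ω` for a uniformly random member of group `g`. -/
def Pr (w : Ω → ℝ) (Grp : X → 𝒢) (g : 𝒢) (E : X → Ω → Prop) : ℝ :=
  Ex w Grp g (fun x ω => if E x ω then 1 else 0)

/-- Conditional probability of `E` given `F`. -/
def cPr (w : Ω → ℝ) (Grp : X → 𝒢) (g : 𝒢) (E F : X → Ω → Prop) : ℝ :=
  Pr w Grp g (fun x ω => E x ω ∧ F x ω) / Pr w Grp g F

/-- `w` is a probability weighting on the randomness space. -/
def ValidWeights (w : Ω → ℝ) : Prop :=
  (∀ ω, 0 ≤ w ω) ∧ ∑ ω : Ω, w ω = 1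

/-- A deferring soft classifier outputs `some s` for a score `s ∈ [0,1]`,
or `none` (i.e. `⊥`, defer). All genuine scores lie in `[0,1]`. -/
def dIsSoft (S : X → Ω → Option ℝ) : Prop :=
  ∀ x ω s, S x ω = some s → 0 ≤ s ∧ s ≤ 1

/-- Groupwise calibration of a deferring soft classifier. -/
def dCalibrated (w : Ω → ℝ) (Grp : X → 𝒢) (Y : X → Bool) (S : X → Ω → Option ℝ) : Prop :=
  ∀ (g : 𝒢) (s : ℝ), 0 < Pr w Grp g (fun x ω => S x ω = some s) →
    cPr w Grp g (fun x _ => Y x = true) (fun x ω => S x ω = some s) = s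

/-- Probability that the deferring soft classifier does not defer on group `g`. -/
def prDef (w : Ω → ℝ) (Grp : X → 𝒢) (S : X → Ω → Option ℝ) (g : 𝒢) : ℝ :=
  Pr w Grp g (fun x ω => S x ω ≠ none)

/-- The conditional accuracy profile of `S` on group `g`: the pmf of the score,
conditioned on not deferring. -/
def cAP (w : Ω → ℝ) (Grp : X → 𝒢) (S : X → Ω → Option ℝ) (g : 𝒢) (s : ℝ) : ℝ :=
  Pr w Grp g (fun x ω => S x ω = some s) / prDef w Grp S g

/-- PPV `Pr[Y = 1 ∣ Ŷ = 1]` of the composed deferring classifier, where `q1 s g`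
is the probability that the deferring post-processor outputs `1`. -/
def oPPV (w : Ω → ℝ) (Grp : X → 𝒢) (Y : X → Bool) (S : X → Ω → Option ℝ)
    (q1 : Option ℝ → 𝒢 → ℝ) (g : 𝒢) : ℝ :=
  Ex w Grp g (fun x ω => (if Y x then 1 else 0) * q1 (S x ω) (Grp x)) /
    Ex w Grp g (fun x ω => q1 (S x ω) (Grp x))

/-- NPV `Pr[Y = 0 ∣ Ŷ = 0]` of the composed deferring classifier, where `q0 s g`
is the probability that the deferring post-processor outputs `0`. -/
def oNPV (w : Ω → ℝ) (Grp : X → 𝒢) (Y : X → Bool) (S : X → Ω → Option ℝ)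
    (q0 : Option ℝ → 𝒢 → ℝ) (g : 𝒢) : ℝ :=
  Ex w Grp g (fun x ω => (if Y x then 0 else 1) * q0 (S x ω) (Grp x)) /
    Ex w Grp g (fun x ω => q0 (S x ω) (Grp x))

/-- Conditional false positive rate `Pr[Ŷ = 1 ∣ Y = 0, Ŷ ≠ ⊥]`. -/
def cFPR (w : Ω → ℝ) (Grp : X → 𝒢) (Y : X → Bool) (S : X → Ω → Option ℝ)
    (q1 q0 : Option ℝ → 𝒢 → ℝ) (g : 𝒢) : ℝ :=
  Ex w Grp g (fun x ω => (if Y x then 0 else 1) * q1 (S x ω) (Grp x)) /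
    Ex w Grp g (fun x ω => (if Y x then 0 else 1) *
      (q1 (S x ω) (Grp x) + q0 (S x ω) (Grp x)))

/-- Conditional false negative rate `Pr[Ŷ = 0 ∣ Y = 1, Ŷ ≠ ⊥]`. -/
def cFNR (w : Ω → ℝ) (Grp : X → 𝒢) (Y : X → Bool) (S : X → Ω → Option ℝ)
    (q1 q0 : Option ℝ → 𝒢 → ℝ) (g : 𝒢) : ℝ :=
  Ex w Grp g (fun x ω => (if Y x then 1 else 0) * q0 (S x ω) (Grp x)) /
    Ex w Grp g (fun x ω => (if Y x then 1 else 0) *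
      (q1 (S x ω) (Grp x) + q0 (S x ω) (Grp x)))

/-- The conditional base rate `Pr[Y = 1 ∣ Ŷ ≠ ⊥]`. -/
def cBR (w : Ω → ℝ) (Grp : X → 𝒢) (Y : X → Bool) (S : X → Ω → Option ℝ)
    (q1 q0 : Option ℝ → 𝒢 → ℝ) (g : 𝒢) : ℝ :=
  Ex w Grp g (fun x ω => (if Y x then 1 else 0) *
      (q1 (S x ω) (Grp x) + q0 (S x ω) (Grp x))) /
    Ex w Grp g (fun x ω => q1 (S x ω) (Grp x) + q0 (S x ω) (Grp x))

section Expectation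

variable {w : Ω → ℝ} {Grp : X → 𝒢} {Y : X → Bool} {S : X → Ω → Option ℝ} {g : 𝒢}

theorem Ex_sum {ι : Type*} (T : Finset ι) (f : ι → X → Ω → ℝ) :
    Ex w Grp g (fun x ω => ∑ i ∈ T, f i x ω) = ∑ i ∈ T, Ex w Grp g (f i) := by
  simp only [Ex, ← Finset.sum_div, Finset.mul_sum]
  rw [Finset.sum_comm (s := T)]
  simp only [Finset.sum_comm (s := T)]

theorem Ex_const_mul (c : ℝ) (f : X → Ω → ℝ) :
    Ex w Grp g (fun x ω => c * f x ω) = c * Ex w Grp g f := by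
  simp only [Ex, mul_left_comm _ c, ← Finset.mul_sum, mul_div_assoc]

theorem Ex_sub (f h : X → Ω → ℝ) :
    Ex w Grp g (fun x ω => f x ω - h x ω) = Ex w Grp g f - Ex w Grp g h := by
  simp only [Ex, mul_sub, Finset.sum_sub_distrib, sub_div]

theorem Ex_mono (hw : ValidWeights w) {f h : X → Ω → ℝ} (hfh : ∀ x ω, f x ω ≤ h x ω) :
    Ex w Grp g f ≤ Ex w Grp g h := by
  unfold Ex
  gcongr with x _ ω _
  · exact hw.1 ω
  · exact hfh x ω

theorem Ex_indicator (E : X → Ω → Prop) [∀ x ω, Decidable (E x ω)] :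
    Ex w Grp g (fun x ω => if E x ω then 1 else 0) = Pr w Grp g E := by
  unfold Pr
  congr!

/-- The finite set of scores that `S` can output. -/
def scores (S : X → Ω → Option ℝ) : Finset ℝ :=
  (Finset.univ.image fun p : X × Ω => S p.1 p.2).eraseNone

theorem Ex_mul_score (h : X → ℝ) {f : Option ℝ → ℝ} (hf : f none = 0) :
    Ex w Grp g (fun x ω => h x * f (S x ω)) =
      ∑ s ∈ scores S,
        f (some s) * Ex w Grp g (fun x ω => h x * if S x ω = some s then 1 else 0) := by
  simp only [← Ex_const_mul, ← Ex_sum]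
  congr 1
  funext x ω
  cases hs : S x ω with
  | none => simp [hf]
  | some t =>
    have ht : t ∈ scores S := by
      simp only [scores, Finset.mem_eraseNone, Finset.mem_image, Finset.mem_univ, true_and]
      exact ⟨(x, ω), hs⟩
    simp [ht, mul_comm]

theorem Pr_some_eq (hdef : 0 < prDef w Grp S g) (s : ℝ) :
    Pr w Grp g (fun x ω => S x ω = some s) = prDef w Grp S g * cAP w Grp S g s :=
  (mul_div_cancel₀ _ hdef.ne').symm

theorem Pr_positive_and_some_eq (hw : ValidWeights w) (hcal : dCalibrated w Grp Y S) (s : ℝ) :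
    Pr w Grp g (fun x ω => Y x = true ∧ S x ω = some s) =
      s * Pr w Grp g (fun x ω => S x ω = some s) := by
  have nonneg (E : X → Ω → Prop) : 0 ≤ Pr w Grp g E := by
    have h := Ex_mono (Grp := Grp) (g := g) hw (f := fun _ _ => 0)
      (h := fun x ω => if E x ω then 1 else 0) fun x ω => by split_ifs <;> simp
    simpa [Ex, Pr] using h
  rcases (nonneg fun x ω => S x ω = some s).eq_or_lt with h0 | hpos
  · rw [← h0, mul_zero]
    refine le_antisymm ?_ (nonneg _)
    rw [h0]
    refine Ex_mono hw fun x ω => ?_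
    by_cases hY : Y x = true <;> by_cases hs : S x ω = some s <;> simp [hY, hs]
  · exact (div_eq_iff hpos.ne').mp (hcal g s hpos)

theorem Ex_score (hdef : 0 < prDef w Grp S g) {f : Option ℝ → ℝ} (hf : f none = 0) :
    Ex w Grp g (fun x ω => f (S x ω)) =
      prDef w Grp S g * ∑ s ∈ scores S, f (some s) * cAP w Grp S g s := by
  have h := Ex_mul_score (w := w) (Grp := Grp) (S := S) (g := g) (fun _ => 1) hf
  simp only [one_mul, Ex_indicator, Pr_some_eq hdef] at h
  rw [h, Finset.mul_sum]
  refine Finset.sum_congr rfl fun s _ => ?_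
  rw [mul_left_comm]

theorem Ex_positive_score (hw : ValidWeights w) (hcal : dCalibrated w Grp Y S)
    (hdef : 0 < prDef w Grp S g) {f : Option ℝ → ℝ} (hf : f none = 0) :
    Ex w Grp g (fun x ω => (if Y x then 1 else 0) * f (S x ω)) =
      prDef w Grp S g * ∑ s ∈ scores S, f (some s) * (s * cAP w Grp S g s) := by
  rw [Ex_mul_score (fun x => if Y x then 1 else 0) hf, Finset.mul_sum]
  refine Finset.sum_congr rfl fun s _ => ?_
  simp only [ite_mul, one_mul, zero_mul, ← ite_and]
  rw [Ex_indicator, Pr_positive_and_some_eq hw hcal, Pr_some_eq hdef]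
  ring

theorem Ex_negative_score (hw : ValidWeights w) (hcal : dCalibrated w Grp Y S)
    (hdef : 0 < prDef w Grp S g) {f : Option ℝ → ℝ} (hf : f none = 0) :
    Ex w Grp g (fun x ω => (if Y x then 0 else 1) * f (S x ω)) =
      prDef w Grp S g * ∑ s ∈ scores S, f (some s) * ((1 - s) * cAP w Grp S g s) := by
  have h : (fun x ω => (if Y x then 0 else 1) * f (S x ω)) =
      fun x ω => f (S x ω) - (if Y x then 1 else 0) * f (S x ω) := by
    funext x ω
    split_ifs <;> simp
  rw [h, Ex_sub, Ex_score hdef hf, Ex_positive_score hw hcal hdef hf, ← mul_sub,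
    ← Finset.sum_sub_distrib]
  congr 1
  exact Finset.sum_congr rfl fun s _ => by ring

end Expectation

/-- If a groupwise calibrated deferring soft classifier has equal
conditional accuracy profiles on two groups, then any group-blind hard deferring
post-processor that defers on `⊥` equalizes PPV, NPV, cFPR and cFNR across the two
groups (given the stated non-degeneracy conditions). -/
theorem equal_conditional_APs_blind_deferring_equalizes_all_four
    (w : Ω → ℝ) (Grp : X → 𝒢) (Y : X → Bool) (S : X → Ω → Option ℝ)
    (q1 q0 : Option ℝ → 𝒢 → ℝ) (g₁ g₂ : 𝒢)
    (hw : ValidWeights w) (hne : ∀ g : 𝒢, (grp Grp g).Nonempty)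
    (hS : dIsSoft S) (hcal : dCalibrated w Grp Y S)
    (hq : ∀ (s : Option ℝ) (g : 𝒢), 0 ≤ q1 s g ∧ 0 ≤ q0 s g ∧ q1 s g + q0 s g ≤ 1)
    (hblind : ∀ (s : Option ℝ) (g g' : 𝒢), q1 s g = q1 s g' ∧ q0 s g = q0 s g')
    (hbot : ∀ g : 𝒢, q1 none g = 0 ∧ q0 none g = 0)
    (hdef₁ : 0 < prDef w Grp S g₁) (hdef₂ : 0 < prDef w Grp S g₂)
    (hcap : ∀ s : ℝ, cAP w Grp S g₁ s = cAP w Grp S g₂ s)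
    (hpos₁ : 0 < Ex w Grp g₁ (fun x ω => q1 (S x ω) (Grp x)))
    (hpos₂ : 0 < Ex w Grp g₂ (fun x ω => q1 (S x ω) (Grp x)))
    (hneg₁ : 0 < Ex w Grp g₁ (fun x ω => q0 (S x ω) (Grp x)))
    (hneg₂ : 0 < Ex w Grp g₂ (fun x ω => q0 (S x ω) (Grp x)))
    (hbr₁ : 0 < cBR w Grp Y S q1 q0 g₁ ∧ cBR w Grp Y S q1 q0 g₁ < 1)
    (hbr₂ : 0 < cBR w Grp Y S q1 q0 g₂ ∧ cBR w Grp Y S q1 q0 g₂ < 1) :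
    oPPV w Grp Y S q1 g₁ = oPPV w Grp Y S q1 g₂ ∧
      oNPV w Grp Y S q0 g₁ = oNPV w Grp Y S q0 g₂ ∧
      cFPR w Grp Y S q1 q0 g₁ = cFPR w Grp Y S q1 q0 g₂ ∧
      cFNR w Grp Y S q1 q0 g₁ = cFNR w Grp Y S q1 q0 g₂ := by
  obtain ⟨r1, h1⟩ : ∃ r : Option ℝ → ℝ, ∀ s g, q1 s g = r s :=
    ⟨fun s => q1 s g₁, fun s g => (hblind s g g₁).1⟩
  obtain ⟨r0, h0⟩ : ∃ r : Option ℝ → ℝ, ∀ s g, q0 s g = r s :=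
    ⟨fun s => q0 s g₁, fun s g => (hblind s g g₁).2⟩
  have b1 : r1 none = 0 := by rw [← h1 none g₁, (hbot g₁).1]
  have b0 : r0 none = 0 := by rw [← h0 none g₁, (hbot g₁).2]
  have b10 : r1 none + r0 none = 0 := by rw [b1, b0, add_zero]
  simp only [oPPV, oNPV, cFPR, cFNR, h1, h0]
  have pos₁ := @Ex_positive_score _ _ _ _ _ w Grp Y S g₁ hw hcal hdef₁
  have pos₂ := @Ex_positive_score _ _ _ _ _ w Grp Y S g₂ hw hcal hdef₂
  have neg₁ := @Ex_negative_score _ _ _ _ _ w Grp Y S g₁ hw hcal hdef₁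
  have neg₂ := @Ex_negative_score _ _ _ _ _ w Grp Y S g₂ hw hcal hdef₂
  rw [Ex_score hdef₁ b1, Ex_score hdef₂ b1, Ex_score hdef₁ b0, Ex_score hdef₂ b0,
    pos₁ b1, pos₂ b1, pos₁ b0, pos₂ b0,
    pos₁ (f := fun s => r1 s + r0 s) b10, pos₂ (f := fun s => r1 s + r0 s) b10,
    neg₁ b1, neg₂ b1, neg₁ b0, neg₂ b0,
    neg₁ (f := fun s => r1 s + r0 s) b10, neg₂ (f := fun s => r1 s + r0 s) b10]
  simp only [mul_div_mul_left _ _ hdef₁.ne', mul_div_mul_left _ _ hdef₂.ne', hcap, and_self]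

end

end GroupFairness
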